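/- arXiv:2511.08939 — 3 statements merged into one kernel-verified Lean document; each statement's English description precedes it below -/
import Mathlib

section
/- Let v > 1 be a fixed real number, and let (F_n), (M_n), (vf_n), (df_n), (dM_n), (w_n), (d_n) be sequences of positive real numbers such that df_n / dM_n → 0, M_n / F_n → 0, vf_n / F_n → 0, and (v · w_n) / d_n → 0 as n → ∞. Define L_n = (F_n·df_n² + F_n²·df_n)·w_n + ((M_n + vf_n)·dM_n² + (M_n + vf_n)²·dM_n)·w_n + v·w_n·(d_n/v)² + (v·w_n)²·(d_n/v), and R_n = ((M_n + F_n)·dM_n² + (M_n + F_n)²·dM_n)·w_n + w_n·d_n² + w_n²·d_n. Then limsup_{n→∞} L_n / R_n ≤ 1/v; in particular L_n < R_n for all sufficiently large n. -/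
open Filter

/-- Shrinking the number of tokens `s ≤ δ t` shrinks the attention cost by a factor `δ ≤ 1`. -/
lemma attention_cost_le_of_tokens_le {s t e δ : ℝ} (hs : 0 ≤ s) (he : 0 ≤ e)
    (hδ : 0 ≤ δ) (hδ1 : δ ≤ 1) (h : s ≤ δ * t) :
    s * e ^ 2 + s ^ 2 * e ≤ δ * (t * e ^ 2 + t ^ 2 * e) := by
  have hst : s ^ 2 ≤ δ * t ^ 2 := by
    calc s ^ 2 ≤ (δ * t) ^ 2 := by gcongr
      _ = δ * (δ * t ^ 2) := by ring
      _ ≤ δ * t ^ 2 := by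
        gcongr
        exact mul_le_of_le_one_left (sq_nonneg t) hδ1
  calc s * e ^ 2 + s ^ 2 * e ≤ δ * t * e ^ 2 + δ * t ^ 2 * e := by gcongr
    _ = δ * (t * e ^ 2 + t ^ 2 * e) := by ring

/-- Splitting each of `w` embeddings into `v` virtual tokens of dimension `d / v`. -/
lemma virtual_token_cost_le {v w d δ : ℝ} (hv : 0 < v) (hw : 0 ≤ w) (hd : 0 ≤ d)
    (hδ : 0 ≤ δ) (h : v * w ≤ δ * d) :
    v * w * (d / v) ^ 2 + (v * w) ^ 2 * (d / v) ≤ (1 / v + δ) * (w * d ^ 2 + w ^ 2 * d) := by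
  have h' : v * w * (w * d) ≤ δ * d * (w * d) := by gcongr
  have h'' : 0 ≤ (1 / v + δ) * (w ^ 2 * d) := by positivity
  calc v * w * (d / v) ^ 2 + (v * w) ^ 2 * (d / v)
      = 1 / v * (w * d ^ 2) + v * w * (w * d) := by field_simp
    _ ≤ 1 / v * (w * d ^ 2) + δ * d * (w * d) + (1 / v + δ) * (w ^ 2 * d) := by linarith
    _ = (1 / v + δ) * (w * d ^ 2 + w ^ 2 * d) := by ring

/-- A positive sequence that is eventually at most `a + ε` for each `ε > 0` has limsup at most
`a`. -/
lemma limsup_le_of_forall_pos_eventually_le {u : ℕ → ℝ} {a : ℝ} (hu : ∀ n, 0 ≤ u n)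
    (h : ∀ ε > 0, ∀ᶠ n in atTop, u n ≤ a + ε) : limsup u atTop ≤ a :=
  le_of_forall_pos_le_add fun ε hε =>
    limsup_le_of_le (isCoboundedUnder_le_of_le atTop hu) (h ε hε)

theorem stmt_0
    (v : ℝ) (hv : 1 < v)
    (F M vf df dM w d : ℕ → ℝ)
    (hF : ∀ n, 0 < F n) (hM : ∀ n, 0 < M n) (hvf : ∀ n, 0 < vf n)
    (hdf : ∀ n, 0 < df n) (hdM : ∀ n, 0 < dM n)
    (hw : ∀ n, 0 < w n) (hd : ∀ n, 0 < d n)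
    (h1 : Tendsto (fun n => df n / dM n) atTop (nhds 0))
    (h2 : Tendsto (fun n => M n / F n) atTop (nhds 0))
    (h3 : Tendsto (fun n => vf n / F n) atTop (nhds 0))
    (h4 : Tendsto (fun n => (v * w n) / d n) atTop (nhds 0))
    (L R : ℕ → ℝ)
    (hL : ∀ n, L n =
      (F n * (df n) ^ 2 + (F n) ^ 2 * df n) * w n
        + ((M n + vf n) * (dM n) ^ 2 + (M n + vf n) ^ 2 * dM n) * w n
        + v * w n * (d n / v) ^ 2 + (v * w n) ^ 2 * (d n / v))
    (hR : ∀ n, R n =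
      ((M n + F n) * (dM n) ^ 2 + (M n + F n) ^ 2 * dM n) * w n
        + w n * (d n) ^ 2 + (w n) ^ 2 * d n) :
    limsup (fun n => L n / R n) atTop ≤ 1 / v ∧
      ∀ᶠ n in atTop, L n < R n := by
  have hv0 : 0 < v := one_pos.trans hv
  have eventually_le_mul {a b : ℕ → ℝ} (hb : ∀ n, 0 < b n)
      (h : Tendsto (fun n => a n / b n) atTop (nhds 0)) {δ : ℝ} (hδ : 0 < δ) :
      ∀ᶠ n in atTop, a n ≤ δ * b n := by
    filter_upwards [h.eventually_lt_const hδ] with n hn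
    exact ((div_lt_iff₀ (hb n)).1 hn).le
  have hRpos (n : ℕ) : 0 < R n := by
    have := hF n; have := hM n; have := hdM n; have := hw n; have := hd n
    rw [hR]; positivity
  have hLpos (n : ℕ) : 0 < L n := by
    have := hF n; have := hM n; have := hvf n; have := hdf n
    have := hdM n; have := hw n; have := hd n
    rw [hL]; positivity
  have key (ε : ℝ) (hε : 0 < ε) : ∀ᶠ n in atTop, L n / R n ≤ 1 / v + ε := by
    obtain ⟨δ, hδ, hδε, hδ1⟩ : ∃ δ : ℝ, 0 < δ ∧ 2 * δ ≤ ε ∧ δ ≤ 1 :=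
      ⟨min (ε / 2) 1, by positivity, by linarith [min_le_left (ε / 2) 1], min_le_right _ _⟩
    filter_upwards [eventually_le_mul hdM h1 hδ, eventually_le_mul hF h2 (half_pos hδ),
      eventually_le_mul hF h3 (half_pos hδ), eventually_le_mul hd h4 hδ] with n e1 e2 e3 e4
    have pF := hF n
    have pM := hM n
    have pvf := hvf n
    have pdM := hdM n
    have pw := hw n
    have pd := hd n
    rw [div_le_iff₀ (hRpos n), hL, hR]
    have feature := attention_cost_le_of_tokens_le (hdf n).le pF.le hδ.le hδ1 e1
    have metadata := attention_cost_le_of_tokens_le (s := M n + vf n) (t := F n) (by positivity)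
      pdM.le hδ.le hδ1 (by linarith)
    have temporal := virtual_token_cost_le hv0 pw.le pd.le hδ.le e4
    set A := F n * dM n ^ 2 + F n ^ 2 * dM n with hA
    set B := (M n + F n) * dM n ^ 2 + (M n + F n) ^ 2 * dM n with hB
    set T := w n * d n ^ 2 + w n ^ 2 * d n with hT
    have hApos : 0 ≤ A := by positivity
    have hTpos : 0 ≤ T := by positivity
    have hAB : A ≤ B := by
      rw [hA, hB]
      gcongr <;> linarith
    calc _ ≤ (2 * δ * A) * w n + (1 / v + δ) * T := by
          have : (F n * df n ^ 2 + F n ^ 2 * df n + ((M n + vf n) * dM n ^ 2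
              + (M n + vf n) ^ 2 * dM n)) * w n ≤ (2 * δ * A) * w n := by
            gcongr
            linarith
          linarith
      _ ≤ ((1 / v + ε) * B) * w n + (1 / v + ε) * T := by
          have : 0 < 1 / v := by positivity
          gcongr <;> linarith
      _ = _ := by rw [hT]; ring
  refine ⟨limsup_le_of_forall_pos_eventually_le
    (fun n => (div_pos (hLpos n) (hRpos n)).le) key, ?_⟩
  have hv1 : 1 / v < 1 := (div_lt_one hv0).2 hv
  filter_upwards [key ((1 - 1 / v) / 2) (by linarith)] with n hn
  exact (div_lt_one (hRpos n)).1 (by linarith)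
end

section
/- Let v > 1 and let d, w be positive real numbers. Then the strict inequality w·d²/v + v·w²·d < w·d² + w²·d holds if and only if w < d/v. -/
theorem stmt_3 (v d w : ℝ) (hv : 1 < v) (hd : 0 < d) (hw : 0 < w) :
    w * d ^ 2 / v + v * w ^ 2 * d < w * d ^ 2 + w ^ 2 * d ↔ w < d / v := by
  have hfactor : w * d ^ 2 + w ^ 2 * d - (w * d ^ 2 / v + v * w ^ 2 * d) =
      w * d * (v - 1) * (d / v - w) := by
    field_simp
    ring
  have hpos : 0 < w * d * (v - 1) := mul_pos (mul_pos hw hd) (sub_pos.mpr hv)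
  rw [← sub_pos, hfactor, mul_pos_iff_of_pos_left hpos, sub_pos]
end

section
/- Let (F_n), (M_n), (vf_n), (df_n), (dM_n) be sequences of positive real numbers such that df_n / dM_n → 0, M_n / F_n → 0, and vf_n / F_n → 0 as n → ∞. Then the ratio ((F_n·df_n² + F_n²·df_n) + ((M_n + vf_n)·dM_n² + (M_n + vf_n)²·dM_n)) / ((M_n + F_n)·dM_n² + (M_n + F_n)²·dM_n) converges to 0. -/
open Filter

theorem stmt_7 (F M vf df dM : ℕ → ℝ)
    (hF : ∀ n, 0 < F n) (hM : ∀ n, 0 < M n) (hvf : ∀ n, 0 < vf n)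
    (hdf : ∀ n, 0 < df n) (hdM : ∀ n, 0 < dM n)
    (h1 : Tendsto (fun n => df n / dM n) atTop (nhds 0))
    (h2 : Tendsto (fun n => M n / F n) atTop (nhds 0))
    (h3 : Tendsto (fun n => vf n / F n) atTop (nhds 0)) :
    Tendsto (fun n =>
      ((F n * (df n) ^ 2 + (F n) ^ 2 * df n)
        + ((M n + vf n) * (dM n) ^ 2 + (M n + vf n) ^ 2 * dM n))
      / ((M n + F n) * (dM n) ^ 2 + (M n + F n) ^ 2 * dM n))
      atTop (nhds 0) := by
  have h4 : Tendsto (fun n => M n / F n + vf n / F n) atTop (nhds 0) := by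
    simpa using h2.add h3
  have hbound : Tendsto (fun n => ((df n / dM n) ^ 2 + df n / dM n)
      + ((M n / F n + vf n / F n) + (M n / F n + vf n / F n) ^ 2)) atTop (nhds 0) := by
    simpa using ((h1.pow 2).add h1).add (h4.add (h4.pow 2))
  refine squeeze_zero (fun n => ?_) (fun n => ?_) hbound
  · have := hF n; have := hM n; have := hvf n; have := hdf n; have := hdM n
    positivity
  · have hFn := hF n
    have hMn := hM n
    have hDn := hdM n
    have ha : 0 < df n / dM n := div_pos (hdf n) hDn
    have ht : 0 < M n / F n + vf n / F n := add_pos (div_pos hMn hFn) (div_pos (hvf n) hFn)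
    have hd : df n = df n / dM n * dM n := by field_simp
    have hs : M n + vf n = (M n / F n + vf n / F n) * F n := by field_simp
    generalize df n / dM n = a at *
    generalize M n / F n + vf n / F n = t at *
    rw [hd, hs, div_le_iff₀ (by positivity)]
    calc F n * (a * dM n) ^ 2 + F n ^ 2 * (a * dM n)
          + (t * F n * dM n ^ 2 + (t * F n) ^ 2 * dM n)
        = (a ^ 2 + t) * (F n * dM n ^ 2) + (a + t ^ 2) * (F n ^ 2 * dM n) := by ring
      _ ≤ (a ^ 2 + a + (t + t ^ 2)) * (F n * dM n ^ 2)
          + (a ^ 2 + a + (t + t ^ 2)) * (F n ^ 2 * dM n) := by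
        gcongr ?_ * _ + ?_ * _ <;> linarith [sq_nonneg a, sq_nonneg t]
      _ = (a ^ 2 + a + (t + t ^ 2)) * (F n * dM n ^ 2 + F n ^ 2 * dM n) := by ring
      _ ≤ (a ^ 2 + a + (t + t ^ 2)) * ((M n + F n) * dM n ^ 2 + (M n + F n) ^ 2 * dM n) := by
        gcongr <;> linarith
end
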